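/- For all ξ, x, y ∈ [0,1), H(ξ, y) − H(ξ, x) = W(y) − W(x) − ∫_x^y S(ξ, z) dz. -/

import Mathlib

open Real MeasureTheory Set Filter

noncomputable section

/-- The Euclidean plane. -/
abbrev E2 : Type := EuclideanSpace ℝ (Fin 2)

/-- The unit vector `(cos t, sin t)` in the Euclidean plane. -/
def cs (t : ℝ) : E2 := (WithLp.equiv 2 (Fin 2 → ℝ)).symm ![Real.cos t, Real.sin t]

/-- The vector `(-sin t, cos t)` in the Euclidean plane. -/
def cs' (t : ℝ) : E2 := (WithLp.equiv 2 (Fin 2 → ℝ)).symm ![-Real.sin t, Real.cos t]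

/-- The two-dimensional Weierstrass function
`W(x) = ∑_{n≥0} 2^{-n/2} (cos (2π 2^n x), sin (2π 2^n x))`. -/
def Wfn (x : ℝ) : E2 := ∑' n : ℕ, (2 : ℝ) ^ (-(n : ℝ) / 2) • cs (2 * π * 2 ^ n * x)

/-- `dig j ξ` is the `j`-th binary digit of `ξ`: `⌊2^j ξ⌋ mod 2` (as a real number). -/
def dig (j : ℕ) (ξ : ℝ) : ℝ := ((⌊(2 : ℝ) ^ j * ξ⌋ % 2 : ℤ) : ℝ)

/-- `rho n ξ = ∑_{i=1}^n d_{n+1-i}(ξ) 2^{-i}`. -/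
def rho (n : ℕ) (ξ : ℝ) : ℝ := ∑ i ∈ Finset.Icc 1 n, dig (n + 1 - i) ξ / 2 ^ i

/-- `x` is a dyadic rational. -/
def dyadic (x : ℝ) : Prop := ∃ (k : ℕ) (m : ℤ), x = (m : ℝ) / 2 ^ k

/-- The stable-direction function
`S(ξ,x) = -2π ∑_{n≥1} 2^{-n/2} (-sin (2π(ρ_n(ξ)+x/2^n)), cos (2π(ρ_n(ξ)+x/2^n)))`. -/
def Sfn (ξ x : ℝ) : E2 :=
  (-(2 * π)) • ∑' n : ℕ,
    (2 : ℝ) ^ (-((n : ℝ) + 1) / 2) • cs' (2 * π * (rho (n + 1) ξ + x / 2 ^ (n + 1)))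

/-- The function `H` given by the doubly infinite series
`H(ξ,x) = ∑_{n≥0} 2^{-n/2} ((cos,sin)(2π 2^n x) - (1,0))
        + ∑_{k≥1} 2^{k/2} ((cos,sin)(2π(ρ_k(ξ)+x/2^k)) - (cos,sin)(2π ρ_k(ξ)))`. -/
def Hfn (ξ x : ℝ) : E2 :=
  (∑' n : ℕ, (2 : ℝ) ^ (-(n : ℝ) / 2) •
      (cs (2 * π * 2 ^ n * x) - (WithLp.equiv 2 (Fin 2 → ℝ)).symm ![1, 0]))
  + ∑' k : ℕ, (2 : ℝ) ^ (((k : ℝ) + 1) / 2) •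
      (cs (2 * π * (rho (k + 1) ξ + x / 2 ^ (k + 1))) - cs (2 * π * rho (k + 1) ξ))

/-- The baker transformation `B(ξ,x) = (2ξ mod 1, (⌊2ξ⌋ + x)/2)`. -/
def baker (p : ℝ × ℝ) : ℝ × ℝ :=
  (Int.fract (2 * p.1), ((⌊2 * p.1⌋ : ℝ) + p.2) / 2)

/-- The unit square `[0,1)²`. -/
def usq : Set (ℝ × ℝ) := Ico (0:ℝ) 1 ×ˢ Ico (0:ℝ) 1

/-- The explicit formula for the `N`-th backward iterate of the baker transformation:
`B^{-N}(ξ,x) = (ξ/2^N + ∑_{j=1}^N d_j(x) 2^{-(N+1-j)}, 2^N x mod 1)`. -/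
def bakerInvN (N : ℕ) (p : ℝ × ℝ) : ℝ × ℝ :=
  (p.1 / 2 ^ N + ∑ j ∈ Finset.Icc 1 N, dig j p.2 / 2 ^ (N + 1 - j),
    Int.fract ((2 : ℝ) ^ N * p.2))

theorem norm_cs (t : ℝ) : ‖cs t‖ = 1 := by
  simp [cs, EuclideanSpace.norm_eq]

theorem norm_cs' (t : ℝ) : ‖cs' t‖ = 1 := by
  simp [cs', EuclideanSpace.norm_eq]

theorem hasDerivAt_cs (t : ℝ) : HasDerivAt cs (cs' t) t := by
  refine ((PiLp.continuousLinearEquiv 2 ℝ fun _ : Fin 2 => ℝ).symm.hasFDerivAt).comp_hasDerivAt t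
    (hasDerivAt_pi.2 fun i => ?_)
  fin_cases i
  · exact Real.hasDerivAt_cos t
  · exact Real.hasDerivAt_sin t

theorem continuous_cs' : Continuous cs' := by
  unfold cs'
  refine (PiLp.continuous_toLp 2 _).comp (continuous_pi fun i => ?_)
  fin_cases i
  · exact Real.continuous_sin.neg
  · exact Real.continuous_cos

theorem two_rpow_neg_half (n : ℕ) :
    (2 : ℝ) ^ (-(n : ℝ) / 2) = ((2 : ℝ) ^ (-(1 / 2 : ℝ))) ^ n := by
  rw [← Real.rpow_natCast, ← Real.rpow_mul two_pos.le]
  congr 1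
  ring

theorem summable_two_rpow_neg_half : Summable fun n : ℕ => (2 : ℝ) ^ (-(n : ℝ) / 2) := by
  simp_rw [two_rpow_neg_half]
  exact summable_geometric_of_lt_one (by positivity)
    (Real.rpow_lt_one_of_one_lt_of_neg one_lt_two (by norm_num))

theorem summable_two_rpow_neg_half_succ :
    Summable fun n : ℕ => (2 : ℝ) ^ (-((n : ℝ) + 1) / 2) := by
  simpa using (summable_nat_add_iff 1).2 summable_two_rpow_neg_half

theorem summable_two_rpow_smul {v : ℕ → E2} {C : ℝ} (hv : ∀ n, ‖v n‖ ≤ C) :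
    Summable fun n : ℕ => (2 : ℝ) ^ (-(n : ℝ) / 2) • v n := by
  refine Summable.of_norm_bounded (summable_two_rpow_neg_half.mul_right C) fun n => ?_
  rw [norm_smul, Real.norm_of_nonneg (by positivity)]
  exact mul_le_mul_of_nonneg_left (hv n) (by positivity)

theorem norm_stable_term (ξ x : ℝ) (n : ℕ) :
    ‖(2 : ℝ) ^ (-((n : ℝ) + 1) / 2) • cs' (2 * π * (rho (n + 1) ξ + x / 2 ^ (n + 1)))‖ =
      (2 : ℝ) ^ (-((n : ℝ) + 1) / 2) := by
  rw [norm_smul, norm_cs', mul_one, Real.norm_of_nonneg (by positivity)]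

theorem continuous_stable_term (ξ : ℝ) (n : ℕ) :
    Continuous fun x : ℝ =>
      (2 : ℝ) ^ (-((n : ℝ) + 1) / 2) • cs' (2 * π * (rho (n + 1) ξ + x / 2 ^ (n + 1))) :=
  (continuous_cs'.comp (g := cs')
    (f := fun x : ℝ => 2 * π * (rho (n + 1) ξ + x / 2 ^ (n + 1))) (by fun_prop)).const_smul
    ((2 : ℝ) ^ (-((n : ℝ) + 1) / 2))

theorem continuous_Sfn (ξ : ℝ) : Continuous (Sfn ξ) :=
  (continuous_tsum (continuous_stable_term ξ) summable_two_rpow_neg_half_succ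
    fun n x => (norm_stable_term ξ x n).le).const_smul (-(2 * π))

theorem integral_stable_term (ξ x : ℝ) (n : ℕ) :
    (2 * π) • ∫ z in (0 : ℝ)..x,
        (2 : ℝ) ^ (-((n : ℝ) + 1) / 2) • cs' (2 * π * (rho (n + 1) ξ + z / 2 ^ (n + 1))) =
      (2 : ℝ) ^ (((n : ℝ) + 1) / 2) •
        (cs (2 * π * (rho (n + 1) ξ + x / 2 ^ (n + 1))) - cs (2 * π * rho (n + 1) ξ)) := by
  have hpow : (2 : ℝ) ^ (((n : ℝ) + 1) / 2) * (2 * π * (1 / 2 ^ (n + 1))) =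
      2 * π * (2 : ℝ) ^ (-((n : ℝ) + 1) / 2) := by
    have h : (2 : ℝ) ^ (((n : ℝ) + 1) / 2) =
        (2 : ℝ) ^ (-((n : ℝ) + 1) / 2) * 2 ^ (n + 1) := by
      rw [← Real.rpow_natCast, ← Real.rpow_add two_pos]
      congr 1
      push_cast
      ring
    rw [h]
    field_simp
  have hderiv (z : ℝ) : HasDerivAt
      (fun z : ℝ => (2 : ℝ) ^ (((n : ℝ) + 1) / 2) •
        cs (2 * π * (rho (n + 1) ξ + z / 2 ^ (n + 1))))
      ((2 * π) • (2 : ℝ) ^ (-((n : ℝ) + 1) / 2) •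
        cs' (2 * π * (rho (n + 1) ξ + z / 2 ^ (n + 1)))) z := by
    have hin : HasDerivAt (fun z : ℝ => 2 * π * (rho (n + 1) ξ + z / 2 ^ (n + 1)))
        (2 * π * (1 / 2 ^ (n + 1))) z :=
      (((hasDerivAt_id z).div_const _).const_add _).const_mul _
    have h := ((hasDerivAt_cs _).scomp z hin).const_smul ((2 : ℝ) ^ (((n : ℝ) + 1) / 2))
    rw [smul_smul, hpow, ← smul_smul] at h
    exact h
  rw [← intervalIntegral.integral_smul, intervalIntegral.integral_eq_sub_of_hasDerivAt
    (fun z _ => hderiv z)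
    (((continuous_stable_term ξ n).const_smul (2 * π)).intervalIntegrable _ _), smul_sub]
  simp

theorem hasSum_unstable_series (ξ x : ℝ) :
    HasSum (fun k : ℕ => (2 : ℝ) ^ (((k : ℝ) + 1) / 2) •
        (cs (2 * π * (rho (k + 1) ξ + x / 2 ^ (k + 1))) - cs (2 * π * rho (k + 1) ξ)))
      (-∫ z in (0 : ℝ)..x, Sfn ξ z) := by
  have h := (intervalIntegral.hasSum_integral_of_dominated_convergence (μ := volume)
    (a := 0) (b := x)
    (F := fun (n : ℕ) (z : ℝ) =>
      (2 : ℝ) ^ (-((n : ℝ) + 1) / 2) • cs' (2 * π * (rho (n + 1) ξ + z / 2 ^ (n + 1))))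
    (fun (n : ℕ) _ => (2 : ℝ) ^ (-((n : ℝ) + 1) / 2))
    (fun n => (continuous_stable_term ξ n).aestronglyMeasurable)
    (fun n => ae_of_all _ fun z _ => (norm_stable_term ξ z n).le)
    (ae_of_all _ fun _ _ => summable_two_rpow_neg_half_succ)
    intervalIntegrable_const
    (ae_of_all _ fun z _ => (Summable.of_norm_bounded summable_two_rpow_neg_half_succ
      fun n => (norm_stable_term ξ z n).le).hasSum)).const_smul (2 * π)
  have hS : -∫ z in (0 : ℝ)..x, Sfn ξ z = (2 * π) • ∫ z in (0 : ℝ)..x, ∑' n : ℕ,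
      (2 : ℝ) ^ (-((n : ℝ) + 1) / 2) • cs' (2 * π * (rho (n + 1) ξ + z / 2 ^ (n + 1))) := by
    simp only [Sfn, intervalIntegral.integral_smul, neg_smul, neg_neg,
      intervalIntegral.integral_neg]
  rw [hS]
  exact h.congr_fun fun n => (integral_stable_term ξ x n).symm

/-- For all `ξ, x, y ∈ [0,1)`: `H(ξ,y) - H(ξ,x) = W(y) - W(x) - ∫_x^y S(ξ,z) dz`. -/
theorem H_increment_eq :
    ∀ ξ x y : ℝ, ξ ∈ Ico (0:ℝ) 1 → x ∈ Ico (0:ℝ) 1 → y ∈ Ico (0:ℝ) 1 →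
      Hfn ξ y - Hfn ξ x = Wfn y - Wfn x - ∫ z in x..y, Sfn ξ z := by
  intro ξ x y _ _ _
  have hbase (t : ℝ) : (∑' n : ℕ, (2 : ℝ) ^ (-(n : ℝ) / 2) •
      (cs (2 * π * 2 ^ n * t) - (WithLp.equiv 2 (Fin 2 → ℝ)).symm ![1, 0])) =
      Wfn t - ∑' n : ℕ, (2 : ℝ) ^ (-(n : ℝ) / 2) •
        ((WithLp.equiv 2 (Fin 2 → ℝ)).symm ![1, 0] : E2) := by
    simp_rw [smul_sub]
    exact (summable_two_rpow_smul fun n => (norm_cs _).le).tsum_sub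
      (summable_two_rpow_smul fun _ => le_rfl)
  have hint (t : ℝ) : IntervalIntegrable (Sfn ξ) volume 0 t :=
    (continuous_Sfn ξ).intervalIntegrable _ _
  rw [Hfn, Hfn, hbase, hbase, (hasSum_unstable_series ξ x).tsum_eq,
    (hasSum_unstable_series ξ y).tsum_eq,
    ← intervalIntegral.integral_interval_sub_left (hint y) (hint x)]
  abel

end
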